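/- Let X be a finite set, {|x⟩}_{x∈X} an orthonormal basis of H_A, {|ψ_x⟩}_{x∈X} an orthonormal family in H_B, p a probability mass function on X, and |ξ⟩ = Σ_{x∈X} √p(x) |x⟩ ⊗ |ψ_x⟩. For each type t ∈ P_n(X), let T_n(t) be its type class, d_t = |T_n(t)|, P(t) = d_t · Π_{i=1}^n p((x_t)_i) for any representative x_t^n ∈ T_n(t), and |Φ_t⟩ = d_t^{−1/2} Σ_{x^n ∈ T_n(t)} |x^n⟩ ⊗ |ψ_{x^n}⟩, where |x^n⟩ = |x_1⟩ ⊗ ⋯ ⊗ |x_n⟩ and |ψ_{x^n}⟩ = |ψ_{x_1}⟩ ⊗ ⋯ ⊗ |ψ_{x_n}⟩. Then: (i) the vectors {|Φ_t⟩ : t ∈ P_n(X)} are orthonormal; (ii) t ↦ P(t) is a probability distribution on P_n(X); (iii) the n-fold tensor power decomposes as |ξ⟩^{⊗n} = Σ_{t ∈ P_n(X)} √P(t) |Φ_t⟩; in particular each |Φ_t⟩ is a maximally entangled state between span{|x^n⟩ : x^n ∈ T_n(t)} ⊆ H_A^{⊗n} and span{|ψ_{x^n}⟩ : x^n ∈ T_n(t)}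 ⊆ H_B^{⊗n}. -/

import Mathlib

open BigOperators

noncomputable section

namespace Types

variable {X : Type} [Fintype X] [DecidableEq X]

/-- The type (empirical occupation counts) of a sequence. -/
def typeOf {n : ℕ} (xn : Fin n → X) : X → ℕ :=
  fun a => (Finset.univ.filter fun i => xn i = a).card

/-- The type class of `t`: all sequences of length `n` with type `t`. -/
def typeClass (n : ℕ) (t : X → ℕ) : Finset (Fin n → X) :=
  Finset.univ.filter fun xn => typeOf xn = t

/-- The set of all types of sequences of length `n`. -/
def types (X : Type) [Fintype X] [DecidableEq X] (n : ℕ) : Finset (X → ℕ) :=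
  Finset.image typeOf (Finset.univ : Finset (Fin n → X))

/-- The tensor-product vector `|x^n⟩ = |x_1⟩ ⊗ ⋯ ⊗ |x_n⟩` built from the family `v`. -/
def vecPow {d : Type} (v : X → d → ℂ) {n : ℕ} (xn : Fin n → X) : (Fin n → d) → ℂ :=
  fun f => ∏ i, v (xn i) (f i)

/-- The probability of the type class of `t` under the i.i.d. law `p`
(equal to `d_t · ∏_i p((x_t)_i)` for any representative `x_t^n`). -/
def Ptype (p : X → ℝ) (n : ℕ) (t : X → ℕ) : ℝ :=
  ∑ xn ∈ typeClass n t, ∏ i, p (xn i)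

/-- The maximally entangled state `|Φ_t⟩` on the type-class subspaces. -/
def PhiT {dA dB : Type} (v : X → dA → ℂ) (w : X → dB → ℂ) (n : ℕ) (t : X → ℕ) :
    ((Fin n → dA) × (Fin n → dB)) → ℂ :=
  fun fg => ((Real.sqrt ((typeClass (X := X) n t).card) : ℂ))⁻¹ *
    ∑ xn ∈ typeClass n t, vecPow v xn fg.1 * vecPow w xn fg.2

theorem mem_typeClass {n : ℕ} {t : X → ℕ} {xn : Fin n → X} :
    xn ∈ typeClass n t ↔ typeOf xn = t := by
  simp [typeClass]

/-- A product over a sequence depends only on the type of the sequence. -/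
theorem prod_eq_prod_pow_typeOf {M : Type*} [CommMonoid M] (q : X → M) {n : ℕ}
    (xn : Fin n → X) : ∏ i, q (xn i) = ∏ a, q a ^ typeOf xn a := by
  rw [← Finset.prod_fiberwise (s := Finset.univ) (g := xn)]
  refine Finset.prod_congr rfl fun a _ => ?_
  rw [Finset.prod_congr rfl (g := fun _ => q a) fun i hi => by rw [(Finset.mem_filter.1 hi).2],
    Finset.prod_const, typeOf]

/-- The type classes partition the set of all sequences. -/
theorem sum_types_sum_typeClass {M : Type*} [AddCommMonoid M] {n : ℕ} (F : (Fin n → X) → M) :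
    ∑ t ∈ types X n, ∑ xn ∈ typeClass n t, F xn = ∑ xn, F xn :=
  Finset.sum_fiberwise_of_maps_to (fun xn _ => Finset.mem_image_of_mem _ (Finset.mem_univ xn)) F

theorem Ptype_eq_card_mul (p : X → ℝ) {n : ℕ} {t : X → ℕ} {xn : Fin n → X}
    (hx : xn ∈ typeClass n t) :
    Ptype p n t = ((typeClass n t).card : ℝ) * ∏ i, p (xn i) := by
  rw [Ptype, Finset.sum_congr rfl (g := fun _ => ∏ i, p (xn i)) fun yn hy => by
    rw [prod_eq_prod_pow_typeOf, prod_eq_prod_pow_typeOf, mem_typeClass.1 hx, mem_typeClass.1 hy],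
    Finset.sum_const, nsmul_eq_mul]

theorem sum_types_Ptype {p : X → ℝ} (hp1 : ∑ x, p x = 1) (n : ℕ) :
    ∑ t ∈ types X n, Ptype p n t = 1 := by
  simp only [Ptype]
  rw [sum_types_sum_typeClass fun xn => ∏ i, p (xn i), ← Fintype.prod_sum fun _ : Fin n => p]
  simp [hp1]

theorem vecPow_orthonormal {d : Type} [Fintype d] {v : X → d → ℂ}
    (hv : ∀ x y, (∑ a, (starRingEnd ℂ) (v x a) * v y a) = if x = y then 1 else 0)
    {n : ℕ} (xn yn : Fin n → X) :
    (∑ f : Fin n → d, (starRingEnd ℂ) (vecPow v xn f) * vecPow v yn f) =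
      if xn = yn then 1 else 0 := by
  simp only [vecPow, map_prod, ← Finset.prod_mul_distrib]
  rw [← Fintype.prod_sum fun i a => (starRingEnd ℂ) (v (xn i) a) * v (yn i) a]
  simp only [hv, Finset.prod_ite_zero, Finset.prod_const_one, Finset.mem_univ, true_imp_iff,
    funext_iff]

theorem PhiT_inner {dA dB : Type} [Fintype dA] [Fintype dB] {v : X → dA → ℂ} {w : X → dB → ℂ}
    (hv : ∀ x y, (∑ a, (starRingEnd ℂ) (v x a) * v y a) = if x = y then 1 else 0)
    (hw : ∀ x y, (∑ b, (starRingEnd ℂ) (w x b) * w y b) = if x = y then 1 else 0)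
    {n : ℕ} {t t' : X → ℕ} (ht : t ∈ types X n) :
    (∑ fg : (Fin n → dA) × (Fin n → dB),
      (starRingEnd ℂ) (PhiT v w n t fg) * PhiT v w n t' fg) = if t = t' then 1 else 0 := by
  have hpair (xn yn : Fin n → X) : (∑ fg : (Fin n → dA) × (Fin n → dB),
      (starRingEnd ℂ) (vecPow v xn fg.1 * vecPow w xn fg.2) *
        (vecPow v yn fg.1 * vecPow w yn fg.2)) = if xn = yn then 1 else 0 := by
    calc _ = (∑ f, (starRingEnd ℂ) (vecPow v xn f) * vecPow v yn f) *
          ∑ g, (starRingEnd ℂ) (vecPow w xn g) * vecPow w yn g := by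
          rw [Fintype.sum_mul_sum, Fintype.sum_prod_type]
          simp only [map_mul, mul_mul_mul_comm]
      _ = _ := by
          rw [vecPow_orthonormal hv, vecPow_orthonormal hw]
          split_ifs <;> simp
  have hexpand : (∑ fg : (Fin n → dA) × (Fin n → dB),
      (starRingEnd ℂ) (PhiT v w n t fg) * PhiT v w n t' fg) =
      ((Real.sqrt (typeClass (X := X) n t).card : ℂ))⁻¹ *
        ((Real.sqrt (typeClass (X := X) n t').card : ℂ))⁻¹ *
        ∑ xn ∈ typeClass n t, ∑ yn ∈ typeClass n t', if xn = yn then 1 else 0 := by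
    simp only [← hpair, PhiT, map_mul, map_inv₀, Complex.conj_ofReal, map_sum]
    simp only [mul_mul_mul_comm _ (∑ _ ∈ typeClass n t, _), ← Finset.mul_sum, Finset.sum_mul_sum]
    congr 1
    rw [Finset.sum_comm]
    refine Finset.sum_congr rfl fun xn _ => ?_
    simp only [Finset.mul_sum]
    exact Finset.sum_comm
  rw [hexpand]
  split_ifs with h
  · subst h
    obtain ⟨xn, -, hx⟩ := Finset.mem_image.1 ht
    have hcard : ((typeClass (X := X) n t).card : ℝ) ≠ 0 :=
      Nat.cast_ne_zero.2 (Finset.card_ne_zero_of_mem (mem_typeClass.2 hx))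
    rw [← mul_inv, ← Complex.ofReal_mul, Real.mul_self_sqrt (Nat.cast_nonneg _)]
    simp only [Finset.sum_ite_eq, Finset.sum_ite_mem, Finset.inter_self, Finset.sum_const,
      nsmul_eq_mul, mul_one, Complex.ofReal_natCast]
    exact inv_mul_cancel₀ (by exact_mod_cast hcard)
  · rw [Finset.sum_eq_zero, mul_zero]
    intro xn hx
    refine Finset.sum_eq_zero fun yn hy => if_neg ?_
    rintro rfl
    exact h ((mem_typeClass.1 hx).symm.trans (mem_typeClass.1 hy))

theorem sqrt_Ptype_mul_PhiT {dA dB : Type} (v : X → dA → ℂ) (w : X → dB → ℂ)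
    {p : X → ℝ} (hp : ∀ x, 0 ≤ p x) {n : ℕ} (t : X → ℕ)
    (fg : (Fin n → dA) × (Fin n → dB)) :
    ((Real.sqrt (Ptype p n t) : ℝ) : ℂ) * PhiT v w n t fg =
      ∑ xn ∈ typeClass n t,
        ∏ i, ((Real.sqrt (p (xn i)) : ℝ) : ℂ) * v (xn i) (fg.1 i) * w (xn i) (fg.2 i) := by
  rw [PhiT, ← mul_assoc, Finset.mul_sum]
  refine Finset.sum_congr rfl fun xn hx => ?_
  have hcard : ((Real.sqrt (typeClass (X := X) n t).card : ℝ) : ℂ) ≠ 0 := by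
    rw [Complex.ofReal_ne_zero]
    exact (Real.sqrt_pos.2 (Nat.cast_pos.2 (Finset.card_pos.2 ⟨xn, hx⟩))).ne'
  rw [Ptype_eq_card_mul p hx, Real.sqrt_mul (Nat.cast_nonneg _),
    Real.sqrt_prod _ fun i _ => hp (xn i), Complex.ofReal_mul,
    mul_comm (Complex.ofReal _), mul_inv_cancel_right₀ hcard, Complex.ofReal_prod]
  simp only [vecPow, Finset.prod_mul_distrib, mul_assoc]

/-- **Type decomposition of a tensor-power entangled state.** With `|ξ⟩ = Σ_x √p(x)
|x⟩ ⊗ |ψ_x⟩`: the tensor-product families over each type class are orthonormal, the vectors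
`|Φ_t⟩` are orthonormal, `P` is a probability distribution on the set of types, `P(t)` equals
`d_t · ∏_i p((x_t)_i)` for every representative, and
`|ξ⟩^{⊗n} = Σ_t √P(t) |Φ_t⟩`; in particular each `|Φ_t⟩` is maximally entangled between the
type-class subspaces. -/
theorem type_decomposition_of_tensor_power {dA dB : Type} [Fintype dA] [Fintype dB]
    (v : X → dA → ℂ) (w : X → dB → ℂ)
    (hv : ∀ x y, (∑ a, (starRingEnd ℂ) (v x a) * v y a) = if x = y then 1 else 0)
    (hw : ∀ x y, (∑ b, (starRingEnd ℂ) (w x b) * w y b) = if x = y then 1 else 0)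
    (p : X → ℝ) (hp : ∀ x, 0 ≤ p x) (hp1 : (∑ x, p x) = 1) (n : ℕ) :
    -- orthonormality of the tensor-product families (maximal entanglement of each `|Φ_t⟩`)
    (∀ xn yn : Fin n → X,
      (∑ f : Fin n → dA, (starRingEnd ℂ) (vecPow v xn f) * vecPow v yn f) =
        if xn = yn then 1 else 0) ∧
    (∀ xn yn : Fin n → X,
      (∑ g : Fin n → dB, (starRingEnd ℂ) (vecPow w xn g) * vecPow w yn g) =
        if xn = yn then 1 else 0) ∧
    -- (i) the vectors `|Φ_t⟩`, `t ∈ P_n(X)`, are orthonormal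
    (∀ t ∈ types X n, ∀ t' ∈ types X n,
      (∑ fg : (Fin n → dA) × (Fin n → dB),
        (starRingEnd ℂ) (PhiT v w n t fg) * PhiT v w n t' fg) =
        if t = t' then 1 else 0) ∧
    -- (ii) `t ↦ P(t)` is a probability distribution on `P_n(X)`,
    -- with `P(t) = d_t · ∏_i p((x_t)_i)` for any representative
    (∀ t, 0 ≤ Ptype p n t) ∧ ((∑ t ∈ types X n, Ptype p n t) = 1) ∧
    (∀ t, ∀ xn ∈ typeClass (X := X) n t,
      Ptype p n t = ((typeClass (X := X) n t).card : ℝ) * ∏ i, p (xn i)) ∧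
    -- (iii) `|ξ⟩^{⊗n} = Σ_t √P(t) |Φ_t⟩`
    (∀ fg : (Fin n → dA) × (Fin n → dB),
      (∏ i, ∑ x, ((Real.sqrt (p x) : ℝ) : ℂ) * v x (fg.1 i) * w x (fg.2 i)) =
        ∑ t ∈ types X n, ((Real.sqrt (Ptype p n t) : ℝ) : ℂ) * PhiT v w n t fg) := by
  refine ⟨vecPow_orthonormal hv, vecPow_orthonormal hw, fun t ht t' _ => PhiT_inner hv hw ht,
    fun t => Finset.sum_nonneg fun xn _ => Finset.prod_nonneg fun i _ => hp (xn i),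
    sum_types_Ptype hp1 n, fun t xn hx => Ptype_eq_card_mul p hx, fun fg => ?_⟩
  simp only [sqrt_Ptype_mul_PhiT v w hp]
  rw [sum_types_sum_typeClass, Fintype.prod_sum]

end Types
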